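/- There exists a bounded lattice L such that the poset M₃[L] of balanced triples is not a lattice; moreover, L can be chosen so that in addition L is not n-modular for any n ≥ 1 (L has modularity rank ∞). -/

import Mathlib

/-- A triple `(x, y, z)` in a lattice is *balanced* if `x ⊓ y = x ⊓ z = y ⊓ z`. -/
def IsBalanced {α : Type*} [Lattice α] (t : α × α × α) : Prop :=
  t.1 ⊓ t.2.1 = t.1 ⊓ t.2.2 ∧ t.1 ⊓ t.2.2 = t.2.1 ⊓ t.2.2

/-- One step of the balancing sequence; `adjT^[n] (x,y,z) = (pₙ, qₙ, rₙ)` at `(x,y,z)`. -/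
def adjT {α : Type*} [Lattice α] (t : α × α × α) : α × α × α :=
  (t.1 ⊔ t.2.1 ⊓ t.2.2, t.2.1 ⊔ t.1 ⊓ t.2.2, t.2.2 ⊔ t.1 ⊓ t.2.1)

/-- A lattice is `n`-modular (satisfies the identity `γₙ : pₙ = pₙ₊₁`). -/
def NModular (α : Type*) [Lattice α] (n : ℕ) : Prop :=
  ∀ t : α × α × α, (adjT^[n] t).1 = (adjT^[n + 1] t).1

section NModular

variable {α : Type*} [Lattice α]

theorem le_adjT (t : α × α × α) : t ≤ adjT t :=
  ⟨le_sup_left, le_sup_left, le_sup_left⟩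

theorem adjT_mono : Monotone (adjT (α := α)) := fun _ _ h =>
  ⟨sup_le_sup h.1 (inf_le_inf h.2.1 h.2.2), sup_le_sup h.2.1 (inf_le_inf h.1 h.2.2),
    sup_le_sup h.2.2 (inf_le_inf h.1 h.2.1)⟩

/-- A triple is balanced exactly when it is fixed by the balancing step. -/
theorem isBalanced_iff_adjT_eq (t : α × α × α) : IsBalanced t ↔ adjT t = t := by
  obtain ⟨x, y, z⟩ := t
  simp only [IsBalanced, adjT, Prod.mk.injEq, sup_eq_left]
  constructor
  · rintro ⟨h₁, h₂⟩
    exact ⟨h₂ ▸ inf_le_left, h₁ ▸ inf_le_right, (h₁.trans h₂) ▸ inf_le_right⟩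
  · rintro ⟨hx, hy, hz⟩
    exact ⟨le_antisymm (le_inf inf_le_left hz) (le_inf inf_le_left hy),
      le_antisymm (le_inf hy inf_le_right) (le_inf hx inf_le_right)⟩

theorem NModular.adjT_iterate_succ {n : ℕ} (h : NModular α n) (t : α × α × α) :
    adjT^[n + 1] t = adjT^[n] t := by
  have swap₁ : Function.Semiconj (fun t : α × α × α => (t.2.1, t.1, t.2.2)) adjT adjT := by
    intro t
    simp only [adjT, inf_comm]
  have swap₂ : Function.Semiconj (fun t : α × α × α => (t.2.2, t.2.1, t.1)) adjT adjT := by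
    intro t
    simp only [adjT, inf_comm]
  have h₁ := h (t.2.1, t.1, t.2.2)
  have h₂ := h (t.2.2, t.2.1, t.1)
  rw [← (swap₁.iterate_right n).eq t, ← (swap₁.iterate_right (n + 1)).eq t] at h₁
  rw [← (swap₂.iterate_right n).eq t, ← (swap₂.iterate_right (n + 1)).eq t] at h₂
  exact (Prod.ext (h t) (Prod.ext h₁ h₂)).symm

/-- In an `n`-modular lattice, `n` balancing steps compute the least balanced triple above a given
one, so the balanced triples have binary least upper bounds. -/
theorem NModular.exists_isLUB {n : ℕ} (h : NModular α n)
    (a b : {t : α × α × α // IsBalanced t}) : ∃ c, IsLUB {a, b} c := by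
  have hle : a.1 ⊔ b.1 ≤ adjT^[n] (a.1 ⊔ b.1) :=
    Function.id_le_iterate_of_id_le le_adjT n _
  refine ⟨⟨adjT^[n] (a.1 ⊔ b.1), (isBalanced_iff_adjT_eq _).2 ?_⟩, ?_, fun c hc => ?_⟩
  · rw [← Function.iterate_succ_apply' adjT, h.adjT_iterate_succ]
  · rintro _ (rfl | rfl)
    · exact le_sup_left.trans hle
    · exact le_sup_right.trans hle
  · have hab : a.1 ⊔ b.1 ≤ c.1 := sup_le (hc (by simp)) (hc (by simp))
    have := adjT_mono.iterate n hab
    rwa [Function.iterate_fixed ((isBalanced_iff_adjT_eq _).1 c.2)] at this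

end NModular

section Glue

variable {C : Type*} [PartialOrder C] [OrderTop C]

/-- The closure operator on `C × Bool × Bool` whose closed elements are a copy of `C` (flags
`false, false`), a copy of the closed elements of `f` (flags `true, false`), a copy of the closed
elements of `g` (flags `false, true`), and the top element. -/
def glueClosure (f g : ClosureOperator C) : ClosureOperator (C × Bool × Bool) :=
  .mk'
    (fun
      | (c, false, false) => (c, false, false)
      | (c, true, false) => (f c, true, false)
      | (c, false, true) => (g c, false, true)
      | (_, true, true) => ⊤)
    (by
      rintro ⟨c, _ | _, _ | _⟩ ⟨d, _ | _, _ | _⟩ ⟨h, h₁, h₂⟩ <;>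
        first
        | exact absurd (show true ≤ false from h₁) (by decide)
        | exact absurd (show true ≤ false from h₂) (by decide)
        | simp_all [Prod.le_def, f.monotone h, g.monotone h, h.trans (f.le_closure d),
            h.trans (g.le_closure d)])
    (by
      rintro ⟨c, _ | _, _ | _⟩ <;>
        simp [Prod.le_def, f.le_closure, g.le_closure])
    (by
      rintro ⟨c, _ | _, _ | _⟩ <;> simp)

theorem glueClosure_isClosed_base (f g : ClosureOperator C) (c : C) :
    (glueClosure f g).IsClosed (c, false, false) :=
  (glueClosure f g).isClosed_iff.2 rfl

theorem glueClosure_isClosed_left (f g : ClosureOperator C) {c : C} :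
    (glueClosure f g).IsClosed (c, true, false) ↔ f c = c := by
  rw [(glueClosure f g).isClosed_iff]
  change (_, _) = (_, _) ↔ _
  simp

theorem glueClosure_isClosed_right (f g : ClosureOperator C) {c : C} :
    (glueClosure f g).IsClosed (c, false, true) ↔ g c = c := by
  rw [(glueClosure f g).isClosed_iff]
  change (_, _) = (_, _) ↔ _
  simp

end Glue

section Closeds

variable {C : Type*} [Lattice C]

instance (c : ClosureOperator C) : Lattice c.Closeds := c.gi.liftLattice

instance [BoundedOrder C] (c : ClosureOperator C) : BoundedOrder c.Closeds := c.gi.liftBoundedOrder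

theorem ClosureOperator.Closeds.coe_inf (c : ClosureOperator C) (a b : c.Closeds) :
    ((a ⊓ b : c.Closeds) : C) = a ⊓ b :=
  c.gi.gc.u_inf

end Closeds

/-- The chain `0 < 1 < 2 < ⋯ < 2' < 1' < 0'`. -/
abbrev GapChain : Type := ℕ ⊕ₗ ℕᵒᵈ

namespace GapChain

/-- The `n`-th element from below. -/
def low (n : ℕ) : GapChain := toLex (Sum.inl n)

/-- The `n`-th element from above. -/
def high (n : ℕ) : GapChain := toLex (Sum.inr (OrderDual.toDual n))

theorem low_le_low {m n : ℕ} : low m ≤ low n ↔ m ≤ n := Sum.Lex.inl_le_inl_iff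

theorem high_le_high {m n : ℕ} : high m ≤ high n ↔ n ≤ m := Sum.Lex.inr_le_inr_iff

theorem low_le_high (m n : ℕ) : low m ≤ high n := Sum.Lex.inl_le_inr _ _

theorem not_high_le_low (m n : ℕ) : ¬ high m ≤ low n := Sum.Lex.not_inr_le_inl

theorem low_injective : Function.Injective low := fun _ _ h =>
  le_antisymm (low_le_low.1 h.le) (low_le_low.1 h.ge)

theorem low_or_high (c : GapChain) : (∃ n, c = low n) ∨ ∃ n, c = high n := by
  rcases c with n | n
  · exact .inl ⟨n, rfl⟩
  · exact .inr ⟨n, rfl⟩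

/-- Nothing sits in the gap: an element below every `high n` is some `low m`. -/
theorem exists_eq_low_of_le_high {c : GapChain} (h : ∀ n, c ≤ high n) : ∃ m, c = low m := by
  obtain hc | ⟨n, rfl⟩ := low_or_high c
  · exact hc
  · exact absurd (high_le_high.1 (h (n + 1))) (by omega)

/-- Extend a closure operator on `ℕ` to the chain by fixing the upper half. -/
def extend (f : ClosureOperator ℕ) : ClosureOperator GapChain :=
  .mk'
    (fun c => Sum.elim (fun n => low (f n)) (fun n => high (OrderDual.ofDual n)) (ofLex c))
    (by
      intro c d h
      obtain ⟨m, rfl⟩ | ⟨m, rfl⟩ := low_or_high c <;>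
        obtain ⟨n, rfl⟩ | ⟨n, rfl⟩ := low_or_high d
      · exact low_le_low.2 (f.monotone (low_le_low.1 h))
      · exact low_le_high _ _
      · exact absurd h (not_high_le_low _ _)
      · exact h)
    (by
      intro c
      obtain ⟨m, rfl⟩ | ⟨m, rfl⟩ := low_or_high c
      · exact low_le_low.2 (f.le_closure m)
      · exact le_rfl)
    (by
      intro c
      obtain ⟨m, rfl⟩ | ⟨m, rfl⟩ := low_or_high c
      · exact low_le_low.2 (f.idempotent m).le
      · exact le_rfl)

theorem extend_low (f : ClosureOperator ℕ) (n : ℕ) : extend f (low n) = low (f n) := rfl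

/-- Rounding up to an even number. -/
def roundEven : ClosureOperator ℕ :=
  .mk' (fun n => n + n % 2) (fun m n h => by dsimp only; omega) (fun n => by omega)
    (fun n => by omega)

/-- Rounding up to an odd number. -/
def roundOdd : ClosureOperator ℕ :=
  .mk' (fun n => n + (n + 1) % 2) (fun m n h => by dsimp only; omega) (fun n => by omega)
    (fun n => by omega)

theorem roundEven_apply (n : ℕ) : roundEven n = n + n % 2 := rfl

theorem roundOdd_apply (n : ℕ) : roundOdd n = n + (n + 1) % 2 := rfl

/-- The closure operator whose closed elements form a lattice in which balanced triples have no
least upper bounds. -/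
abbrev gapClosure : ClosureOperator (GapChain × Bool × Bool) :=
  glueClosure (extend roundEven) (extend roundOdd)

/-- The element of the lattice corresponding to `c` in the unmarked copy of the chain. -/
def base (c : GapChain) : gapClosure.Closeds :=
  ⟨(c, false, false), glueClosure_isClosed_base _ _ c⟩

/-- The element of the lattice over a chain element closed under rounding up to evens. -/
def left (c : GapChain) (h : extend roundEven c = c) : gapClosure.Closeds :=
  ⟨(c, true, false), (glueClosure_isClosed_left _ _).2 h⟩

/-- The element of the lattice over a chain element closed under rounding up to odds. -/
def right (c : GapChain) (h : extend roundOdd c = c) : gapClosure.Closeds :=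
  ⟨(c, false, true), (glueClosure_isClosed_right _ _).2 h⟩

theorem inf_eq_base {a b : gapClosure.Closeds} {c : GapChain} (h₁ : a.1.1 ⊓ b.1.1 = c)
    (h₂ : a.1.2 ⊓ b.1.2 = (false, false)) : a ⊓ b = base c :=
  Subtype.ext ((ClosureOperator.Closeds.coe_inf _ _ _).trans (Prod.ext h₁ h₂))

theorem isBalanced_left_base_right :
    IsBalanced (left (low 0) rfl, base ⊥, right (low 1) rfl) :=
  have h₁ : left (low 0) rfl ⊓ base ⊥ = base ⊥ := inf_eq_base rfl rfl
  have h₂ : left (low 0) rfl ⊓ right (low 1) rfl = base ⊥ := inf_eq_base rfl rfl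
  have h₃ : base ⊥ ⊓ right (low 1) rfl = base ⊥ := inf_eq_base rfl rfl
  ⟨h₁.trans h₂.symm, h₂.trans h₃.symm⟩

theorem isBalanced_base_top : IsBalanced (base ⊥, base ⊤, base ⊥) :=
  have h₁ : base ⊥ ⊓ base ⊤ = base ⊥ := inf_eq_base rfl rfl
  have h₂ : base ⊥ ⊓ base ⊥ = base ⊥ := inf_eq_base rfl rfl
  have h₃ : base ⊤ ⊓ base ⊥ = base ⊥ := inf_eq_base rfl rfl
  ⟨h₁.trans h₂.symm, h₂.trans h₃.symm⟩

theorem isBalanced_high (n : ℕ) :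
    IsBalanced (left (high n) rfl, base ⊤, right (high n) rfl) :=
  have h₁ : left (high n) rfl ⊓ base ⊤ = base (high n) := inf_eq_base (inf_top_eq _) rfl
  have h₂ : left (high n) rfl ⊓ right (high n) rfl = base (high n) :=
    inf_eq_base (inf_idem _) rfl
  have h₃ : base ⊤ ⊓ right (high n) rfl = base (high n) := inf_eq_base (top_inf_eq _) rfl
  ⟨h₁.trans h₂.symm, h₂.trans h₃.symm⟩

theorem exists_not_isLUB :
    ∃ a b : {t : gapClosure.Closeds × gapClosure.Closeds × gapClosure.Closeds // IsBalanced t},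
      ¬ ∃ c, IsLUB {a, b} c := by
  refine ⟨⟨_, isBalanced_left_base_right⟩, ⟨_, isBalanced_base_top⟩, ?_⟩
  rintro ⟨⟨⟨p, q, r⟩, hbal⟩, hub, hlub⟩
  obtain ⟨hp, -, hr⟩ : left (low 0) rfl ≤ p ∧ base ⊥ ≤ q ∧ right (low 1) rfl ≤ r :=
    hub (Set.mem_insert _ _)
  obtain ⟨-, hq, -⟩ : base ⊥ ≤ p ∧ base ⊤ ≤ q ∧ base ⊥ ≤ r :=
    hub (Set.mem_insert_of_mem _ rfl)
  have hle (n : ℕ) : p ≤ left (high n) rfl ∧ q ≤ base ⊤ ∧ r ≤ right (high n) rfl := by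
    refine hlub (show ⟨_, isBalanced_high n⟩ ∈ upperBounds _ from ?_)
    rintro _ (rfl | rfl)
    · exact ⟨⟨low_le_high _ _, le_rfl⟩, ⟨bot_le, le_rfl⟩, ⟨low_le_high _ _, le_rfl⟩⟩
    · exact ⟨⟨bot_le, bot_le⟩, le_rfl, ⟨bot_le, bot_le⟩⟩
  obtain rfl : q = base ⊤ := le_antisymm (hle 0).2.1 hq
  obtain ⟨⟨p, i⟩, hpc⟩ := p
  obtain ⟨⟨r, j⟩, hrc⟩ := r
  obtain rfl : i = (true, false) := le_antisymm (hle 0).1.2 hp.2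
  obtain rfl : j = (false, true) := le_antisymm (hle 0).2.2.2 hr.2
  obtain ⟨m, rfl⟩ := exists_eq_low_of_le_high fun n => (hle n).1.1
  obtain ⟨n, rfl⟩ := exists_eq_low_of_le_high fun n => (hle n).2.2.1
  rw [glueClosure_isClosed_left, extend_low, roundEven_apply] at hpc
  rw [glueClosure_isClosed_right, extend_low, roundOdd_apply] at hrc
  have hmn : low m ⊓ ⊤ = ⊤ ⊓ low n := congrArg (fun a => a.1.1) (hbal.1.trans hbal.2)
  rw [inf_top_eq, top_inf_eq] at hmn
  have := low_injective hmn
  have := low_injective hpc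
  have := low_injective hrc
  omega

end GapChain

/-- There is a bounded lattice `L` such that the poset `M₃[L]` of balanced triples is not a
lattice (some pair of balanced triples has no least upper bound), and moreover `L` is not
`n`-modular for any `n ≥ 1` (its modularity rank is `∞`). -/
theorem stmt8 :
    ∃ (α : Type) (_ : Lattice α) (_ : BoundedOrder α),
      (¬ ∀ a b : {t : α × α × α // IsBalanced t}, ∃ c, IsLUB {a, b} c) ∧
      (∀ n : ℕ, 0 < n → ¬ NModular α n) := by
  obtain ⟨a, b, hab⟩ := GapChain.exists_not_isLUB
  exact ⟨GapChain.gapClosure.Closeds, inferInstance, inferInstance, fun h => hab (h a b),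
    fun n _ hn => hab (hn.exists_isLUB a b)⟩
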